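/- arXiv:2507.14264 — 3 statements merged into one kernel-verified Lean document; each statement's English description precedes it below -/
import Mathlib

section
/- Let L > 0, α > 0. Let u⁰, u¹, m⁰, m¹ : ℝ → ℝ be L-periodic continuously differentiable functions, let g : ℝ → ℝ be an L-periodic continuous function, and set u^{1/2} := (u⁰ + u¹)/2. Assume that for each i ∈ {0,1} and every L-periodic continuously differentiable test function ψ : ℝ → ℝ one has ∫₀^L (uⁱ(x) ψ(x) + α² (uⁱ)′(x) ψ′(x)) dx = ∫₀^L mⁱ(x) ψ(x) dx, and that for every L-periodic continuously differentiable test function φ : ℝ → ℝ one has ∫₀^L (m¹(x) − m⁰(x)) φ(x) dx + ∫₀^L g(x) (u^{1/2})′(x) φ(x) dx − ∫₀^L g(x) u^{1/2}(x) φ′(x) dx = 0. Then the discrete energy is exactly conserved: ∫₀^L ((u¹(x))² + α² ((u¹)′(x))²) dx = ∫₀^L ((u⁰(x))² + α² ((u⁰)′(x))²) dx. -/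
/-- Energy conservation for the implicit-midpoint weak-form time step of the
SFLT stochastic Camassa–Holm equation (Proposition 3.1), stated pathwise:
`g` plays the role of the perturbed midpoint momentum. -/
theorem sflt_discrete_energy_conservation
    (L α : ℝ) (hL : 0 < L) (hα : 0 < α)
    (u0 u1 m0 m1 g : ℝ → ℝ)
    (hu0 : ContDiff ℝ 1 u0) (hu1 : ContDiff ℝ 1 u1)
    (hm0 : ContDiff ℝ 1 m0) (hm1 : ContDiff ℝ 1 m1)
    (hg : Continuous g)
    (pu0 : Function.Periodic u0 L) (pu1 : Function.Periodic u1 L)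
    (pm0 : Function.Periodic m0 L) (pm1 : Function.Periodic m1 L)
    (pg : Function.Periodic g L)
    (hhelm0 : ∀ ψ : ℝ → ℝ, ContDiff ℝ 1 ψ → Function.Periodic ψ L →
      (∫ x in (0:ℝ)..L, (u0 x * ψ x + α ^ 2 * deriv u0 x * deriv ψ x)) =
      ∫ x in (0:ℝ)..L, m0 x * ψ x)
    (hhelm1 : ∀ ψ : ℝ → ℝ, ContDiff ℝ 1 ψ → Function.Periodic ψ L →
      (∫ x in (0:ℝ)..L, (u1 x * ψ x + α ^ 2 * deriv u1 x * deriv ψ x)) =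
      ∫ x in (0:ℝ)..L, m1 x * ψ x)
    (hstep : ∀ φ : ℝ → ℝ, ContDiff ℝ 1 φ → Function.Periodic φ L →
      (∫ x in (0:ℝ)..L, (m1 x - m0 x) * φ x)
        + (∫ x in (0:ℝ)..L, g x * deriv (fun y => (u0 y + u1 y) / 2) x * φ x)
        - (∫ x in (0:ℝ)..L, g x * ((u0 x + u1 x) / 2) * deriv φ x) = 0) :
    (∫ x in (0:ℝ)..L, ((u1 x) ^ 2 + α ^ 2 * (deriv u1 x) ^ 2)) =
      ∫ x in (0:ℝ)..L, ((u0 x) ^ 2 + α ^ 2 * (deriv u0 x) ^ 2) := by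
  set w : ℝ → ℝ := fun y => (u0 y + u1 y) / 2 with hw
  have cw : ContDiff ℝ 1 w := (hu0.add hu1).div_const 2
  have pw : Function.Periodic w L := fun x => by simp only [hw, pu0 x, pu1 x]
  have dw : ∀ x, deriv w x = (deriv u0 x + deriv u1 x) / 2 := fun x =>
    (((hu0.differentiable one_ne_zero x).hasDerivAt.add
      (hu1.differentiable one_ne_zero x).hasDerivAt).div_const 2).deriv
  have c0 := hu0.continuous
  have c1 := hu1.continuous
  have cm0 := hm0.continuous
  have cm1 := hm1.continuous
  have ccw := cw.continuous
  have d0 : Continuous (deriv u0) := hu0.continuous_deriv le_rfl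
  have d1 : Continuous (deriv u1) := hu1.continuous_deriv le_rfl
  have cdw : Continuous (deriv w) := cw.continuous_deriv le_rfl
  -- Testing the step with the midpoint velocity cancels the transport terms.
  have transport : (∫ x in (0:ℝ)..L, g x * deriv w x * w x) =
      ∫ x in (0:ℝ)..L, g x * ((u0 x + u1 x) / 2) * deriv w x :=
    intervalIntegral.integral_congr fun x _ => mul_right_comm _ _ _
  have momentum : (∫ x in (0:ℝ)..L, m1 x * w x) = ∫ x in (0:ℝ)..L, m0 x * w x := by
    have step := hstep w cw pw
    rw [transport, add_sub_cancel_right] at step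
    rw [← sub_eq_zero, ← intervalIntegral.integral_sub
      (Continuous.intervalIntegrable (by fun_prop) _ _)
      (Continuous.intervalIntegrable (by fun_prop) _ _)]
    simpa only [sub_mul] using step
  have helmholtz := (hhelm1 w cw pw).trans (momentum.trans (hhelm0 w cw pw).symm)
  rw [← sub_eq_zero, ← intervalIntegral.integral_sub
    (Continuous.intervalIntegrable (by fun_prop) _ _)
    (Continuous.intervalIntegrable (by fun_prop) _ _)] at helmholtz ⊢
  refine Eq.trans ?_ ((congrArg (2 * ·) helmholtz).trans (mul_zero 2))
  simp only [← intervalIntegral.integral_const_mul]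
  refine intervalIntegral.integral_congr fun x _ => ?_
  simp only [dw]
  simp only [hw]
  ring
end

section
/- Let L > 0, α > 0. Let u⁰, u¹, m⁰, m¹ : ℝ → ℝ be L-periodic continuously differentiable functions, and set u^{1/2} := (u⁰ + u¹)/2. Assume that for each i ∈ {0,1} and every L-periodic continuously differentiable test function ψ : ℝ → ℝ one has ∫₀^L (uⁱ(x) ψ(x) + α² (uⁱ)′(x) ψ′(x)) dx = ∫₀^L mⁱ(x) ψ(x) dx. Then ½∫₀^L ((u¹)² + α²((u¹)′)²) dx − ½∫₀^L ((u⁰)² + α²((u⁰)′)²) dx = ∫₀^L u^{1/2}(x) (m¹(x) − m⁰(x)) dx. -/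
/-- Key intermediate identity in the proof of discrete energy conservation:
the difference of discrete energies between consecutive time levels equals the
pairing of the midpoint velocity with the momentum increment. -/
theorem discrete_energy_difference_eq_midpoint_pairing
    (L α : ℝ) (hL : 0 < L) (hα : 0 < α)
    (u0 u1 m0 m1 : ℝ → ℝ)
    (hu0 : ContDiff ℝ 1 u0) (hu1 : ContDiff ℝ 1 u1)
    (hm0 : ContDiff ℝ 1 m0) (hm1 : ContDiff ℝ 1 m1)
    (pu0 : Function.Periodic u0 L) (pu1 : Function.Periodic u1 L)
    (pm0 : Function.Periodic m0 L) (pm1 : Function.Periodic m1 L)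
    (hhelm0 : ∀ ψ : ℝ → ℝ, ContDiff ℝ 1 ψ → Function.Periodic ψ L →
      (∫ x in (0:ℝ)..L, (u0 x * ψ x + α ^ 2 * deriv u0 x * deriv ψ x)) =
      ∫ x in (0:ℝ)..L, m0 x * ψ x)
    (hhelm1 : ∀ ψ : ℝ → ℝ, ContDiff ℝ 1 ψ → Function.Periodic ψ L →
      (∫ x in (0:ℝ)..L, (u1 x * ψ x + α ^ 2 * deriv u1 x * deriv ψ x)) =
      ∫ x in (0:ℝ)..L, m1 x * ψ x) :
    (1 / 2) * (∫ x in (0:ℝ)..L, ((u1 x) ^ 2 + α ^ 2 * (deriv u1 x) ^ 2))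
      - (1 / 2) * (∫ x in (0:ℝ)..L, ((u0 x) ^ 2 + α ^ 2 * (deriv u0 x) ^ 2))
      = ∫ x in (0:ℝ)..L, ((u0 x + u1 x) / 2) * (m1 x - m0 x) := by
  have hint : ∀ {m u : ℝ → ℝ}, ContDiff ℝ 1 m → ContDiff ℝ 1 u →
      IntervalIntegrable (fun x => m x * u x) MeasureTheory.volume 0 L :=
    fun hm hu => (hm.continuous.mul hu.continuous).intervalIntegrable 0 L
  have hrhs : (∫ x in (0:ℝ)..L, ((u0 x + u1 x) / 2) * (m1 x - m0 x)) =
      (1 / 2) * (((∫ x in (0:ℝ)..L, m1 x * u0 x) + ∫ x in (0:ℝ)..L, m1 x * u1 x)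
        - ((∫ x in (0:ℝ)..L, m0 x * u0 x) + ∫ x in (0:ℝ)..L, m0 x * u1 x)) := by
    rw [← intervalIntegral.integral_add (hint hm1 hu0) (hint hm1 hu1),
      ← intervalIntegral.integral_add (hint hm0 hu0) (hint hm0 hu1),
      ← intervalIntegral.integral_sub ((hint hm1 hu0).add (hint hm1 hu1))
        ((hint hm0 hu0).add (hint hm0 hu1)),
      ← intervalIntegral.integral_const_mul]
    congr with x
    ring
  have hsymm : (∫ x in (0:ℝ)..L, m1 x * u0 x) = ∫ x in (0:ℝ)..L, m0 x * u1 x := by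
    rw [← hhelm1 u0 hu0 pu0, ← hhelm0 u1 hu1 pu1]
    congr with x
    ring
  have henergy : ∀ u : ℝ → ℝ,
      (∫ x in (0:ℝ)..L, ((u x) ^ 2 + α ^ 2 * (deriv u x) ^ 2)) =
        ∫ x in (0:ℝ)..L, (u x * u x + α ^ 2 * deriv u x * deriv u x) := by
    intro u
    congr with x
    ring
  rw [hrhs, hsymm, henergy, henergy, hhelm0 u0 hu0 pu0, hhelm1 u1 hu1 pu1]
  ring
end

section
/- Let c ∈ ℝ and define u : ℝ × ℝ → ℝ by u(t, x) := c e^{−|x − ct|}. Then for every t ∈ ℝ and every x ≠ ct, u is differentiable in t and x at (t, x), the function x ↦ ∫_ℝ ½ e^{−|x−y|} (u(t, y)² + ½ (∂_y u(t, y))²) dy is differentiable at x, and ∂_t u(t, x) + u(t, x) ∂_x u(t, x) = − ∂_x [ ∫_ℝ ½ e^{−|x−y|} (u(t, y)² + ½ (∂_y u(t, y))²) dy ]. -/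
open MeasureTheory Set

/-- The convolution of `e^{-|·|}` with `e^{-2|·|}`, evaluated at a nonnegative point. -/
theorem integral_exp_neg_abs_sub_mul_exp_neg_two_mul_abs_of_nonneg {z : ℝ} (hz : 0 ≤ z) :
    ∫ y : ℝ, Real.exp (-|z - y|) * Real.exp (-2 * |y|) =
      4 / 3 * Real.exp (-z) - 2 / 3 * Real.exp (-2 * z) := by
  set f : ℝ → ℝ := fun y => Real.exp (-|z - y|) * Real.exp (-2 * |y|) with hf
  have hleft : EqOn f (fun y => Real.exp (-z) * Real.exp (3 * y)) (Iic 0) := by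
    intro y (hy : y ≤ 0)
    simp only [hf, abs_of_nonneg (show 0 ≤ z - y by linarith), abs_of_nonpos hy, ← Real.exp_add]
    ring_nf
  have hmid : EqOn f (fun y => Real.exp (-z) * Real.exp (-y)) (uIcc 0 z) := by
    intro y hy
    rw [uIcc_of_le hz] at hy
    simp only [hf, abs_of_nonneg (sub_nonneg.2 hy.2), abs_of_nonneg hy.1, ← Real.exp_add]
    ring_nf
  have hright : EqOn f (fun y => Real.exp z * Real.exp (-3 * y)) (Ioi z) := by
    intro y (hy : z < y)
    simp only [hf, abs_of_nonpos (show z - y ≤ 0 by linarith),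
      abs_of_nonneg (show 0 ≤ y by linarith), ← Real.exp_add]
    ring_nf
  have hleft_int : IntegrableOn f (Iic 0) :=
    (integrableOn_congr_fun hleft measurableSet_Iic).2
      ((integrableOn_exp_mul_Iic (by norm_num) 0).const_mul _)
  have hright_int : IntegrableOn f (Ioi z) :=
    (integrableOn_congr_fun hright measurableSet_Ioi).2
      ((integrableOn_exp_mul_Ioi (by norm_num) z).const_mul _)
  have hf_cont : Continuous f := by fun_prop
  have hpos_int : IntegrableOn f (Ioi 0) := by
    rw [← Ioc_union_Ioi_eq_Ioi hz]
    exact (hf_cont.integrableOn_Ioc).union hright_int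
  rw [← intervalIntegral.integral_Iic_add_Ioi hleft_int hpos_int,
    ← intervalIntegral.integral_interval_add_Ioi hpos_int hright_int,
    setIntegral_congr_fun measurableSet_Iic hleft, intervalIntegral.integral_congr hmid,
    setIntegral_congr_fun measurableSet_Ioi hright, integral_const_mul, integral_const_mul,
    intervalIntegral.integral_const_mul, integral_exp_mul_Iic (by norm_num),
    integral_exp_mul_Ioi (by norm_num), intervalIntegral.integral_comp_neg, integral_exp]
  have htwo : Real.exp (-2 * z) = Real.exp (-z) * Real.exp (-z) := by
    rw [← Real.exp_add]; ring_nf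
  have hthree : Real.exp z * Real.exp (-3 * z) = Real.exp (-z) * Real.exp (-z) := by
    rw [← Real.exp_add, ← Real.exp_add]; ring_nf
  simp only [mul_zero, neg_zero, Real.exp_zero]
  linear_combination (1 / 3 : ℝ) * hthree + (2 / 3 : ℝ) * htwo

/-- The convolution of `e^{-|·|}` with `e^{-2|·|}`. -/
theorem integral_exp_neg_abs_sub_mul_exp_neg_two_mul_abs (z : ℝ) :
    ∫ y : ℝ, Real.exp (-|z - y|) * Real.exp (-2 * |y|) =
      4 / 3 * Real.exp (-|z|) - 2 / 3 * Real.exp (-2 * |z|) := by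
  rcases le_total 0 z with hz | hz
  · rw [abs_of_nonneg hz, integral_exp_neg_abs_sub_mul_exp_neg_two_mul_abs_of_nonneg hz]
  · rw [abs_of_nonpos hz,
      ← integral_exp_neg_abs_sub_mul_exp_neg_two_mul_abs_of_nonneg (neg_nonneg.2 hz),
      ← integral_neg_eq_self]
    congr! 5 with y
    · rw [← abs_neg]; ring_nf
    · rw [abs_neg]

/-- The exponential `a e^{-k|g|}` is differentiable wherever `g` is differentiable and nonzero. -/
theorem HasDerivAt.const_mul_exp_neg_abs {g : ℝ → ℝ} {g' x : ℝ} (hg : HasDerivAt g g' x)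
    (hx : g x ≠ 0) (a k : ℝ) :
    HasDerivAt (fun y => a * Real.exp (-k * |g y|))
      (-(a * k * g' * SignType.sign (g x) * Real.exp (-k * |g x|))) x := by
  have habs : HasDerivAt (fun y => |g y|) (SignType.sign (g x) * g') x :=
    (hasDerivAt_abs hx).comp x hg
  exact ((habs.const_mul (-k)).exp.const_mul a).congr_deriv (by ring)

theorem hasDerivAt_peakon_space {c t x : ℝ} (hx : x ≠ c * t) :
    HasDerivAt (fun y => c * Real.exp (-|y - c * t|))
      (-(c * SignType.sign (x - c * t) * Real.exp (-|x - c * t|))) x := by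
  simpa using ((hasDerivAt_id x).sub_const (c * t)).const_mul_exp_neg_abs (sub_ne_zero.2 hx) c 1

theorem hasDerivAt_peakon_time {c t x : ℝ} (hx : x ≠ c * t) :
    HasDerivAt (fun s => c * Real.exp (-|x - c * s|))
      (c ^ 2 * SignType.sign (x - c * t) * Real.exp (-|x - c * t|)) t := by
  have hg : HasDerivAt (fun s => x - c * s) (-c) t := by
    simpa using ((hasDerivAt_id t).const_mul c).const_sub x
  have h := hg.const_mul_exp_neg_abs (sub_ne_zero.2 hx) c 1
  simp only [neg_mul, one_mul] at h
  exact h.congr_deriv (by ring)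

theorem sq_coe_sign_of_ne_zero {x : ℝ} (hx : x ≠ 0) :
    ((SignType.sign x : SignType) : ℝ) ^ 2 = 1 := by
  rcases hx.lt_or_gt with h | h <;> simp [h]

/-- The nonlocal pressure `K ∗ (u² + ½u_x²)` of the peakon, in closed form. -/
theorem integral_peakon_pressure (c t x : ℝ) :
    ∫ y : ℝ, (1 / 2) * Real.exp (-|x - y|) *
        ((c * Real.exp (-|y - c * t|)) ^ 2 +
          (1 / 2) * (deriv (fun y => c * Real.exp (-|y - c * t|)) y) ^ 2) =
      c ^ 2 * Real.exp (-1 * |x - c * t|) - c ^ 2 / 2 * Real.exp (-2 * |x - c * t|) := by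
  have hae : (fun y : ℝ => (1 / 2) * Real.exp (-|x - y|) *
        ((c * Real.exp (-|y - c * t|)) ^ 2 +
          (1 / 2) * (deriv (fun y => c * Real.exp (-|y - c * t|)) y) ^ 2)) =ᵐ[volume]
      fun y => 3 / 4 * c ^ 2 *
        (Real.exp (-|x - c * t - (y - c * t)|) * Real.exp (-2 * |y - c * t|)) := by
    filter_upwards [Measure.ae_ne volume (c * t)] with y hy
    have hexp : Real.exp (-2 * |y - c * t|) = Real.exp (-|y - c * t|) ^ 2 := by
      rw [← Real.exp_nat_mul]; push_cast; ring_nf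
    rw [(hasDerivAt_peakon_space hy).deriv, sub_sub_sub_cancel_right, hexp]
    linear_combination (1 / 4) * Real.exp (-|x - y|) * c ^ 2 * Real.exp (-|y - c * t|) ^ 2 *
      sq_coe_sign_of_ne_zero (sub_ne_zero.2 hy)
  rw [integral_congr_ae hae, integral_const_mul,
    integral_sub_right_eq_self
      (fun y => Real.exp (-|x - c * t - y|) * Real.exp (-2 * |y|)) (c * t),
    integral_exp_neg_abs_sub_mul_exp_neg_two_mul_abs, neg_one_mul]
  ring


/-- The single peakon `u(t, x) = c e^{−|x − ct|}` solves the hydrodynamic form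
of the Camassa–Holm equation (with `α = 1`),
`u_t + u u_x = −∂_x (K ∗ (u² + ½u_x²))`, `K(x) = ½e^{−|x|}`,
at every point away from the peak `x = ct`. -/
theorem peakon_solves_hydrodynamic_camassa_holm
    (c : ℝ) (u : ℝ → ℝ → ℝ)
    (hu : ∀ t x, u t x = c * Real.exp (-|x - c * t|)) :
    ∀ t x : ℝ, x ≠ c * t →
      DifferentiableAt ℝ (fun s => u s x) t ∧
      DifferentiableAt ℝ (u t) x ∧
      DifferentiableAt ℝ
        (fun x' => ∫ y : ℝ, (1 / 2) * Real.exp (-|x' - y|) *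
          ((u t y) ^ 2 + (1 / 2) * (deriv (u t) y) ^ 2)) x ∧
      deriv (fun s => u s x) t + u t x * deriv (u t) x =
        -deriv
          (fun x' => ∫ y : ℝ, (1 / 2) * Real.exp (-|x' - y|) *
            ((u t y) ^ 2 + (1 / 2) * (deriv (u t) y) ^ 2)) x := by
  intro t x hx
  obtain rfl : u = fun t x => c * Real.exp (-|x - c * t|) := funext₂ hu
  have htime := hasDerivAt_peakon_time hx
  have hspace := hasDerivAt_peakon_space hx
  have hsub : HasDerivAt (fun y => y - c * t) 1 x := (hasDerivAt_id x).sub_const (c * t)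
  have hpressure := (hsub.const_mul_exp_neg_abs (sub_ne_zero.2 hx) (c ^ 2) 1).sub
    (hsub.const_mul_exp_neg_abs (sub_ne_zero.2 hx) (c ^ 2 / 2) 2)
  replace hpressure := hpressure.congr_of_eventuallyEq
    (Filter.Eventually.of_forall fun x' => integral_peakon_pressure c t x')
  refine ⟨htime.differentiableAt, hspace.differentiableAt, hpressure.differentiableAt, ?_⟩
  have hexp : Real.exp (-2 * |x - c * t|) = Real.exp (-|x - c * t|) ^ 2 := by
    rw [← Real.exp_nat_mul]; push_cast; ring_nf
  rw [hpressure.deriv, htime.deriv, hspace.deriv, hexp, neg_one_mul]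
  ring
end
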